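/- Suppose the LMI conditions (6) are feasible, define X, Y, Z, F_o, R from a feasible solution, and let θ ∈ [0,1]. Then every feedback gain F ∈ ℝ^{m×n} satisfying the shrunk ellipsoidal constraint (F − F_o) Z (F − F_o)ᵀ ⪯ θ·R also satisfies (F − F_o) Z (F − F_o)ᵀ ⪯ R, and consequently A + BF is Hurwitz and for every ω ∈ ℝ the matrix iω·I − (A + BF) is invertible with ‖(C + D_gu F)(iω·I − (A + BF))⁻¹ B_v + D_gv‖ ≤ γ (ℓ²→ℓ² operator norm). -/

import Mathlib

open Matrix

/-- The ℓ²→ℓ² operator norm (maximum singular value) of a complex matrix. -/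
noncomputable def l2OpNorm {p q : ℕ} (M : Matrix (Fin p) (Fin q) ℂ) : ℝ :=
  ‖LinearMap.toContinuousLinearMap (Matrix.toEuclideanLin M)‖

open scoped MatrixOrder ComplexOrder in
theorem Matrix.PosDef.map_complex_ofReal {ι : Type*} [Fintype ι] [DecidableEq ι]
    {M : Matrix ι ι ℝ} (hM : M.PosDef) : (M.map Complex.ofReal).PosDef := by
  obtain ⟨S, hS⟩ := CStarAlgebra.nonneg_iff_eq_star_mul_self.mp hM.posSemidef.nonneg
  have hmap : M.map Complex.ofReal =
      (S.map Complex.ofReal)ᴴ * S.map Complex.ofReal := by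
    rw [hS, star_eq_conjTranspose]
    ext i j
    simp [mul_apply]
  have hpsd : (M.map Complex.ofReal).PosSemidef := by
    rw [hmap]
    exact posSemidef_conjTranspose_mul_self _
  exact hpsd.posDef_iff_isUnit.mpr (hM.isUnit.map Complex.ofRealHom.mapMatrix)

open scoped ComplexOrder in
/-- A continuous-time Lyapunov inequality forces the spectrum into the open left half plane. -/
theorem spectrum_re_neg_of_lyapunov {ι : Type*} [Fintype ι] [DecidableEq ι]
    {K P : Matrix ι ι ℂ} (hP : P.PosSemidef) (hK : (-(K * P + P * Kᴴ)).PosDef) :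
    ∀ μ ∈ spectrum ℂ K, μ.re < 0 := by
  intro μ hμ
  rw [spectrum.mem_iff, isUnit_iff_isUnit_det, isUnit_iff_ne_zero, not_not,
    ← exists_vecMul_eq_zero_iff] at hμ
  obtain ⟨v, hv, hvK⟩ := hμ
  rw [Algebra.algebraMap_eq_smul_one, vecMul_sub, vecMul_smul, vecMul_one, sub_eq_zero] at hvK
  have hw : Kᴴ *ᵥ star v = star μ • star v := by
    rw [← star_vecMul, ← hvK, star_smul]
  have hneg := hK.dotProduct_mulVec_pos (x := star v) (by simpa using hv)
  have hnn := hP.dotProduct_mulVec_nonneg (star v)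
  rw [star_star] at hneg hnn
  have hquad : v ⬝ᵥ (-(K * P + P * Kᴴ)) *ᵥ star v =
      -((μ + star μ) * (v ⬝ᵥ P *ᵥ star v)) := by
    rw [neg_mulVec, dotProduct_neg, add_mulVec, dotProduct_add, ← mulVec_mulVec,
      ← mulVec_mulVec, hw, dotProduct_mulVec v K, ← hvK, mulVec_smul, dotProduct_smul,
      smul_dotProduct, smul_eq_mul, smul_eq_mul, add_mul]
  rw [hquad, Complex.lt_def] at hneg
  obtain ⟨hre, him⟩ := Complex.le_def.mp hnn
  have h := hneg.1
  simp at h hre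
  nlinarith

open scoped ComplexOrder in
/-- A Gram matrix bound `M * Mᴴ ⪯ γ² I` bounds the operator norm. -/
theorem l2OpNorm_le_of_posSemidef {p q : ℕ} {M : Matrix (Fin p) (Fin q) ℂ} {γ : ℝ} (hγ : 0 ≤ γ)
    (hM : (((γ : ℂ) ^ 2) • (1 : Matrix (Fin p) (Fin p) ℂ) - M * Mᴴ).PosSemidef) :
    l2OpNorm M ≤ γ := by
  have hadj : l2OpNorm M = l2OpNorm Mᴴ := (l2_opNorm_conjTranspose M).symm
  rw [hadj]
  refine ContinuousLinearMap.opNorm_le_bound _ hγ fun y => ?_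
  refine le_of_sq_le_sq ?_ (by positivity)
  have h := hM.dotProduct_mulVec_nonneg y.ofLp
  have hsq (k : ℕ) (z : EuclideanSpace ℂ (Fin k)) :
      star z.ofLp ⬝ᵥ z.ofLp = ((‖z‖ ^ 2 : ℝ) : ℂ) := by
    rw [dotProduct_comm, ← EuclideanSpace.inner_eq_star_dotProduct, inner_self_eq_norm_sq_to_K]
    simp
  have hMy : star y.ofLp ⬝ᵥ (M * Mᴴ) *ᵥ y.ofLp =
      star (Mᴴ *ᵥ y.ofLp) ⬝ᵥ (Mᴴ *ᵥ y.ofLp) := by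
    rw [← mulVec_mulVec, dotProduct_mulVec, star_mulVec, conjTranspose_conjTranspose]
  have hlin := hsq q (toEuclideanLin Mᴴ y)
  rw [ofLp_toLpLin, toLin'_apply] at hlin
  rw [sub_mulVec, dotProduct_sub, hMy, smul_mulVec, one_mulVec, dotProduct_smul, hsq p y, hlin,
    smul_eq_mul, sub_nonneg, ← Complex.ofReal_pow, ← Complex.ofReal_mul,
    Complex.real_le_real] at h
  rwa [mul_pow]

open scoped ComplexOrder in
/-- The bounded-real LMI bounds the transfer matrix at every imaginary point `s` off the spectrum. -/
theorem l2OpNorm_transfer_le {n m p : ℕ} {K P : Matrix (Fin n) (Fin n) ℂ}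
    {H : Matrix (Fin p) (Fin n) ℂ} {Bv : Matrix (Fin n) (Fin m) ℂ}
    {Dv : Matrix (Fin p) (Fin m) ℂ} {γ : ℝ} (hγ : 0 ≤ γ)
    (hLMI : (-(fromBlocks (K * P + P * Kᴴ) (P * Hᴴ) (H * P)
      (-((γ : ℂ) ^ 2) • (1 : Matrix (Fin p) (Fin p) ℂ))
      + fromRows Bv Dv * (fromRows Bv Dv)ᴴ)).PosSemidef)
    {s : ℂ} (hs : star s = -s) (hu : IsUnit (s • (1 : Matrix (Fin n) (Fin n) ℂ) - K)) :
    l2OpNorm (H * (s • (1 : Matrix (Fin n) (Fin n) ℂ) - K)⁻¹ * Bv + Dv) ≤ γ := by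
  apply l2OpNorm_le_of_posSemidef hγ
  set L := s • (1 : Matrix (Fin n) (Fin n) ℂ) - K with hL
  set W := H * L⁻¹ with hW
  have hH : H = W * L := by
    rw [hW, Matrix.mul_assoc, nonsing_inv_mul _ ((isUnit_iff_isUnit_det _).mp hu), Matrix.mul_one]
  have hcancel : W * (K * P + P * Kᴴ) * Wᴴ + W * (P * Hᴴ) + H * P * Wᴴ = 0 := by
    rw [hH, hL]
    simp only [conjTranspose_mul, conjTranspose_sub, conjTranspose_smul, hs,
      Matrix.mul_add, Matrix.add_mul, Matrix.mul_sub, Matrix.sub_mul, Matrix.mul_assoc,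
      Matrix.smul_mul, Matrix.mul_smul, Matrix.mul_one, neg_smul,
      Matrix.mul_neg]
    abel
  have h := hLMI.mul_mul_conjTranspose_same (fromCols W (1 : Matrix (Fin p) (Fin p) ℂ))
  have hgram : fromCols W (1 : Matrix (Fin p) (Fin p) ℂ) * fromRows Bv Dv = W * Bv + Dv := by
    rw [fromCols_mul_fromRows, Matrix.one_mul]
  have hblocks : fromCols W (1 : Matrix (Fin p) (Fin p) ℂ) *
      fromBlocks (K * P + P * Kᴴ) (P * Hᴴ) (H * P)
        (-((γ : ℂ) ^ 2) • (1 : Matrix (Fin p) (Fin p) ℂ)) *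
      (fromCols W (1 : Matrix (Fin p) (Fin p) ℂ))ᴴ
      = -((γ : ℂ) ^ 2 • (1 : Matrix (Fin p) (Fin p) ℂ)) := by
    rw [conjTranspose_fromCols_eq_fromRows_conjTranspose, fromCols_mul_fromBlocks,
      fromCols_mul_fromRows, conjTranspose_one, Matrix.mul_one, Matrix.one_mul, Matrix.one_mul,
      Matrix.add_mul, neg_smul, ← sub_eq_zero, ← hcancel]
    abel
  rw [Matrix.mul_neg, Matrix.neg_mul, Matrix.mul_add, Matrix.add_mul, hblocks,
    ← Matrix.mul_assoc, Matrix.mul_assoc _ _ (fromCols W (1 : Matrix (Fin p) (Fin p) ℂ))ᴴ,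
    ← conjTranspose_mul, hgram, neg_add, neg_neg, ← sub_eq_add_neg] at h
  exact h

open scoped ComplexOrder in
/-- The sufficiency half of the bounded real lemma, for a real system. -/
theorem hurwitz_and_l2OpNorm_transfer_le {n q p : ℕ} {A P : Matrix (Fin n) (Fin n) ℝ}
    {C : Matrix (Fin p) (Fin n) ℝ} {Bv : Matrix (Fin n) (Fin q) ℝ}
    {Dv : Matrix (Fin p) (Fin q) ℝ} {γ : ℝ} (hγ : 0 ≤ γ) (hP : P.PosDef)
    (hcl : (-(fromBlocks (A * P + P * Aᵀ) (P * Cᵀ) (C * P)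
      (-(γ ^ 2) • (1 : Matrix (Fin p) (Fin p) ℝ))
      + fromRows Bv Dv * (fromRows Bv Dv)ᵀ)).PosDef) :
    (∀ μ ∈ spectrum ℂ (A.map Complex.ofReal), μ.re < 0) ∧
    (∀ ω : ℝ,
      IsUnit (((ω : ℂ) * Complex.I) • (1 : Matrix (Fin n) (Fin n) ℂ) - A.map Complex.ofReal) ∧
      l2OpNorm (C.map Complex.ofReal
          * (((ω : ℂ) * Complex.I) • (1 : Matrix (Fin n) (Fin n) ℂ)
              - A.map Complex.ofReal)⁻¹
          * Bv.map Complex.ofReal + Dv.map Complex.ofReal) ≤ γ) := by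
  have hcl' := hcl.map_complex_ofReal
  have hPc := hP.map_complex_ofReal
  set K := A.map Complex.ofReal
  set H := C.map Complex.ofReal
  set Pc := P.map Complex.ofReal
  set Bc := Bv.map Complex.ofReal
  set Dc := Dv.map Complex.ofReal
  have hmap : (-(fromBlocks (A * P + P * Aᵀ) (P * Cᵀ)
      (C * P) (-(γ ^ 2) • (1 : Matrix (Fin p) (Fin p) ℝ))
      + fromRows Bv Dv * (fromRows Bv Dv)ᵀ)).map Complex.ofReal
      = -(fromBlocks (K * Pc + Pc * Kᴴ) (Pc * Hᴴ) (H * Pc)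
      (-((γ : ℂ) ^ 2) • (1 : Matrix (Fin p) (Fin p) ℂ))
      + fromRows Bc Dc * (fromRows Bc Dc)ᴴ) := by
    ext (i | i) (j | j) <;>
      simp [K, H, Pc, Bc, Dc, mul_apply, one_apply, apply_ite Complex.ofReal]
  rw [hmap] at hcl'
  have hlyap : (-(K * Pc + Pc * Kᴴ)).PosDef := by
    have h := (hcl'.submatrix (e := Sum.inl) Sum.inl_injective).add_posSemidef
      (posSemidef_self_mul_conjTranspose Bc)
    convert h using 1
    ext i j
    simp [mul_apply]
  have hspec := spectrum_re_neg_of_lyapunov hPc.posSemidef hlyap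
  refine ⟨hspec, fun ω => ?_⟩
  have hu : IsUnit (((ω : ℂ) * Complex.I) • (1 : Matrix (Fin n) (Fin n) ℂ) - K) := by
    by_contra hnot
    have h := hspec (ω * Complex.I) (by
      rwa [spectrum.mem_iff, Algebra.algebraMap_eq_smul_one])
    simp at h
  exact ⟨hu, l2OpNorm_transfer_le hγ hcl'.posSemidef (by simp) hu⟩

/-- Completing the square: the LMI in the relaxed variables, together with the ellipsoidal
bound on `G`, yields the bounded-real LMI of the perturbed closed loop. -/
theorem posDef_closedLoop_of_ellipsoid {n m p : Type*} [Fintype n] [Fintype m] [Fintype p]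
    [DecidableEq n] [DecidableEq p]
    {S Zh : Matrix n n ℝ} {B : Matrix n m ℝ} {T : Matrix p n ℝ} {U : Matrix p p ℝ}
    {D : Matrix p m ℝ} {X : Matrix m m ℝ} {G : Matrix m n ℝ} {N : Matrix (n ⊕ p) (n ⊕ p) ℝ}
    (hZh : Zh.PosDef) (hX : (-X - G * Zh⁻¹ * Gᵀ).PosSemidef)
    (hLMI : (-(fromBlocks (S - B * X * Bᵀ + Zh) ((T - D * X * Bᵀ)ᵀ) (T - D * X * Bᵀ)
      (U - D * X * Dᵀ) + N)).PosDef) :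
    (-(fromBlocks (S + (B * G + (B * G)ᵀ)) ((T + D * G)ᵀ) (T + D * G) U + N)).PosDef := by
  have hE := hX.mul_mul_conjTranspose_same (fromRows B D)
  have hJ := hZh.posSemidef.mul_mul_conjTranspose_same (fromRows (B * G * Zh⁻¹ - 1) (D * G * Zh⁻¹))
  have hsum := (hLMI.add_posSemidef hE).add_posSemidef hJ
  have hXt : Xᵀ = X := by
    have h1 := hX.isHermitian.eq
    have h2 := hZh.inv.isHermitian.eq
    simp only [conjTranspose_eq_transpose_of_trivial, transpose_sub, transpose_neg,
      transpose_mul, transpose_transpose] at h1 h2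
    rw [h2, ← Matrix.mul_assoc] at h1
    simpa using h1
  have hZt : (Zh⁻¹)ᵀ = Zh⁻¹ := by simpa using hZh.inv.isHermitian.eq
  have hdet := (isUnit_iff_isUnit_det _).mp hZh.isUnit
  convert hsum using 1
  rw [neg_add_rev, neg_add_rev, add_assoc, add_assoc, add_right_inj]
  rw [conjTranspose_fromRows_eq_fromCols_conjTranspose,
    conjTranspose_fromRows_eq_fromCols_conjTranspose, fromRows_mul B D (_ - _),
    fromRows_mul _ _ Zh,
    fromRows_mul_fromCols, fromRows_mul_fromCols, fromBlocks_neg, fromBlocks_neg,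
    fromBlocks_add, fromBlocks_add]
  simp only [conjTranspose_eq_transpose_of_trivial, transpose_add, transpose_sub,
    transpose_mul, transpose_one, transpose_transpose, hXt, hZt, Matrix.mul_sub, Matrix.sub_mul,
    Matrix.mul_neg, Matrix.neg_mul, Matrix.mul_one, Matrix.one_mul, Matrix.mul_assoc,
    nonsing_inv_mul _ hdet, mul_nonsing_inv_cancel_left _ _ hdet]
  congr 1 <;> abel

/-- For `θ ∈ [0,1]`, any feedback gain in the shrunk ellipsoid
`(F − F_o) Z (F − F_o)ᵀ ⪯ θ R` also lies in the full ellipsoid, and hence `A + BF` is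
Hurwitz and the closed loop achieves the γ-level H∞ disturbance attenuation. -/
theorem shrunk_ellipsoid_guarantees {n m m_v p : ℕ}
    (A : Matrix (Fin n) (Fin n) ℝ) (B : Matrix (Fin n) (Fin m) ℝ)
    (Bv : Matrix (Fin n) (Fin m_v) ℝ) (C : Matrix (Fin p) (Fin n) ℝ)
    (Dgu : Matrix (Fin p) (Fin m) ℝ) (Dgv : Matrix (Fin p) (Fin m_v) ℝ)
    (γ : ℝ) (hγ : 0 < γ)
    (P : Matrix (Fin n) (Fin n) ℝ) (Xh : Matrix (Fin m) (Fin m) ℝ)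
    (Yh : Matrix (Fin m) (Fin n) ℝ) (Zh : Matrix (Fin n) (Fin n) ℝ)
    (hP : P.PosDef) (hXh : (-Xh).PosSemidef) (hZh : Zh.PosDef)
    (hLMI : (-(fromBlocks
        (A * P - B * Yh + (A * P - B * Yh)ᵀ - B * Xh * Bᵀ + Zh)
        ((C * P - Dgu * Xh * Bᵀ - Dgu * Yh)ᵀ)
        (C * P - Dgu * Xh * Bᵀ - Dgu * Yh)
        (-(γ ^ 2) • (1 : Matrix (Fin p) (Fin p) ℝ) - Dgu * Xh * Dguᵀ)
        + fromRows Bv Dgv * (fromRows Bv Dgv)ᵀ)).PosDef)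
    (θ : ℝ) (hθ : θ ∈ Set.Icc (0 : ℝ) 1)
    (F : Matrix (Fin m) (Fin n) ℝ)
    (hF : let X := Xh + Yh * Zh⁻¹ * Yhᵀ
          let Y := Yh * Zh⁻¹ * P
          let Z := P * Zh⁻¹ * P
          let Fo := -(Y * Z⁻¹)
          let R := Y * Z⁻¹ * Yᵀ - X
          (θ • R - (F - Fo) * Z * (F - Fo)ᵀ).PosSemidef) :
    (let X := Xh + Yh * Zh⁻¹ * Yhᵀ
     let Y := Yh * Zh⁻¹ * P
     let Z := P * Zh⁻¹ * P
     let Fo := -(Y * Z⁻¹)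
     let R := Y * Z⁻¹ * Yᵀ - X
     ((R - (F - Fo) * Z * (F - Fo)ᵀ).PosSemidef)) ∧
    (∀ μ ∈ spectrum ℂ ((A + B * F).map Complex.ofReal), μ.re < 0) ∧
    (∀ ω : ℝ,
      IsUnit (((ω : ℂ) * Complex.I) • (1 : Matrix (Fin n) (Fin n) ℂ)
          - (A + B * F).map Complex.ofReal) ∧
      l2OpNorm ((C + Dgu * F).map Complex.ofReal
          * (((ω : ℂ) * Complex.I) • (1 : Matrix (Fin n) (Fin n) ℂ)
              - (A + B * F).map Complex.ofReal)⁻¹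
          * Bv.map Complex.ofReal + Dgv.map Complex.ofReal) ≤ γ) := by
  have hPd := (isUnit_iff_isUnit_det _).mp hP.isUnit
  have hZd := (isUnit_iff_isUnit_det _).mp hZh.isUnit
  have hPt : Pᵀ = P := by simpa using hP.isHermitian.eq
  have hZinv : (P * Zh⁻¹ * P)⁻¹ = P⁻¹ * Zh * P⁻¹ := by
    rw [Matrix.mul_inv_rev, Matrix.mul_inv_rev, nonsing_inv_nonsing_inv _ hZd, Matrix.mul_assoc]
  have hYZ : Yh * Zh⁻¹ * P * (P * Zh⁻¹ * P)⁻¹ = Yh * P⁻¹ := by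
    rw [hZinv]
    simp only [Matrix.mul_assoc, mul_nonsing_inv_cancel_left _ _ hPd,
      nonsing_inv_mul_cancel_left _ _ hZd]
  have hR : Yh * Zh⁻¹ * P * (P * Zh⁻¹ * P)⁻¹ * (Yh * Zh⁻¹ * P)ᵀ - (Xh + Yh * Zh⁻¹ * Yhᵀ)
      = -Xh := by
    have hZt : (Zh⁻¹)ᵀ = Zh⁻¹ := by simpa using hZh.inv.isHermitian.eq
    rw [hYZ, transpose_mul, transpose_mul, hPt, hZt]
    simp only [Matrix.mul_assoc, nonsing_inv_mul_cancel_left _ _ hPd]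
    abel
  simp only [hR] at hF ⊢
  simp only [hYZ, sub_neg_eq_add] at hF ⊢
  have hfull : (-Xh - (F + Yh * P⁻¹) * (P * Zh⁻¹ * P) * (F + Yh * P⁻¹)ᵀ).PosSemidef := by
    convert hF.add (hXh.smul (sub_nonneg.mpr hθ.2)) using 1
    rw [sub_smul, one_smul]
    abel
  refine ⟨hfull, ?_⟩
  set G := F * P + Yh with hG
  have hGΔ : (F + Yh * P⁻¹) * P = G := by
    rw [Matrix.add_mul, Matrix.mul_assoc, nonsing_inv_mul _ hPd, Matrix.mul_one]
  have hGX : (-Xh - G * Zh⁻¹ * Gᵀ).PosSemidef := by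
    convert hfull using 2
    rw [← hGΔ, transpose_mul, hPt]
    simp only [Matrix.mul_assoc]
  have hcl : (-(fromBlocks ((A + B * F) * P + P * (A + B * F)ᵀ) (P * (C + Dgu * F)ᵀ)
      ((C + Dgu * F) * P) (-(γ ^ 2) • (1 : Matrix (Fin p) (Fin p) ℝ))
      + fromRows Bv Dgv * (fromRows Bv Dgv)ᵀ)).PosDef := by
    have h := posDef_closedLoop_of_ellipsoid (S := A * P - B * Yh + (A * P - B * Yh)ᵀ)
      (T := C * P - Dgu * Yh) (B := B) (D := Dgu)
      (U := -(γ ^ 2) • (1 : Matrix (Fin p) (Fin p) ℝ))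
      (N := fromRows Bv Dgv * (fromRows Bv Dgv)ᵀ) hZh hGX
      (by rwa [sub_right_comm (C * P)])
    have hT : C * P - Dgu * Yh + Dgu * G = (C + Dgu * F) * P := by
      rw [hG, Matrix.mul_add, Matrix.add_mul, Matrix.mul_assoc]
      abel
    have hS : A * P - B * Yh + (A * P - B * Yh)ᵀ + (B * G + (B * G)ᵀ)
        = (A + B * F) * P + P * (A + B * F)ᵀ := by
      have h1 : A * P - B * Yh + B * G = (A + B * F) * P := by
        rw [hG, Matrix.mul_add, Matrix.add_mul, Matrix.mul_assoc]
        abel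
      rw [add_add_add_comm, ← transpose_add, h1, transpose_mul, hPt]
    rwa [hT, hS, transpose_mul, hPt] at h
  exact hurwitz_and_l2OpNorm_transfer_le hγ.le hP hcl
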